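/- arXiv:2406.14814 — 2 statements merged into one kernel-verified Lean document; each statement's English description precedes it below -/
import Mathlib

section
/- Let p : [0,1]² → ℝ be a bivariate copula density, i.e., p is twice continuously differentiable, p(u,v) > 0 on [0,1]², ∫₀¹ p(u,v) du = 1 for every v ∈ [0,1], and ∫₀¹ p(u,v) dv = 1 for every u ∈ [0,1]. Suppose there is a real constant λ ≠ 0 such that ∂²/∂u∂v log p(u,v) = λ · p(u,v) for all (u,v) ∈ (0,1)². Then p is the Frank copula density with parameter θ = λ/2; that is, p(u,v) = θ(1−e^{−θ})e^{−θ(u+v)} / [1 − e^{−θ} − (1−e^{−θu})(1−e^{−θv})]² with θ = λ/2. -/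
/-- The Frank copula density with parameter `θ ≠ 0`. -/
noncomputable def frankDensity (θ u v : ℝ) : ℝ :=
  θ * (1 - Real.exp (-θ)) * Real.exp (-θ * (u + v)) /
    (1 - Real.exp (-θ) - (1 - Real.exp (-θ * u)) * (1 - Real.exp (-θ * v))) ^ 2

/-- A bivariate copula density: twice continuously differentiable on `[0,1]²`,
positive, with uniform marginals. -/
structure IsCopulaDensity (p : ℝ → ℝ → ℝ) : Prop where
  smooth : ContDiffOn ℝ 2 (Function.uncurry p) (Set.Icc 0 1 ×ˢ Set.Icc 0 1)
  pos : ∀ u ∈ Set.Icc (0 : ℝ) 1, ∀ v ∈ Set.Icc (0 : ℝ) 1, 0 < p u v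
  margU : ∀ v ∈ Set.Icc (0 : ℝ) 1, (∫ u in (0 : ℝ)..1, p u v) = 1
  margV : ∀ u ∈ Set.Icc (0 : ℝ) 1, (∫ v in (0 : ℝ)..1, p u v) = 1

open Set in
/-- A continuous function on `[0,1]` whose derivative vanishes on `(0,1)` is constant. -/
theorem eq_left_of_hasDerivAt_zero {f : ℝ → ℝ} (hc : ContinuousOn f (Icc 0 1))
    (hd : ∀ x ∈ Ioo (0 : ℝ) 1, HasDerivAt f 0 x) : ∀ x ∈ Icc (0 : ℝ) 1, f x = f 0 := by
  intro x hx
  rcases hx.1.eq_or_lt with h0 | h0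
  · rw [← h0]
  obtain ⟨c, -, hc'⟩ := exists_hasDerivAt_eq_slope f (fun _ => 0) h0
    (hc.mono (Icc_subset_Icc_right hx.2)) (fun y hy => hd y ⟨hy.1, hy.2.trans_le hx.2⟩)
  rcases div_eq_zero_iff.1 hc'.symm with h | h <;> linarith

open Set in
/-- The denominator of the Frank density does not vanish on the unit square. -/
theorem frankDensity_denom_ne_zero {θ : ℝ} (hθ : θ ≠ 0) {u v : ℝ} (hu : u ∈ Icc (0 : ℝ) 1)
    (hv : v ∈ Icc (0 : ℝ) 1) :
    1 - Real.exp (-θ) - (1 - Real.exp (-θ * u)) * (1 - Real.exp (-θ * v)) ≠ 0 := by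
  rcases lt_or_gt_of_ne hθ with h | h
  · have h1 : 1 < Real.exp (-θ) := Real.one_lt_exp_iff.2 (by linarith)
    have h2 : 1 ≤ Real.exp (-θ * u) := Real.one_le_exp (by nlinarith [hu.1])
    have h3 : 1 ≤ Real.exp (-θ * v) := Real.one_le_exp (by nlinarith [hv.1])
    nlinarith
  · have h1 : Real.exp (-θ) < 1 := Real.exp_lt_one_iff.2 (by linarith)
    have h2 : Real.exp (-θ) ≤ Real.exp (-θ * u) := Real.exp_le_exp.2 (by nlinarith [hu.2])
    have h3 : Real.exp (-θ) ≤ Real.exp (-θ * v) := Real.exp_le_exp.2 (by nlinarith [hv.2])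
    have h4 : Real.exp (-θ * u) ≤ 1 := Real.exp_le_one_iff.2 (by nlinarith [hu.1])
    have h5 := Real.exp_pos (-θ)
    have h6 : (1 - Real.exp (-θ * u)) * (1 - Real.exp (-θ * v)) ≤
        (1 - Real.exp (-θ)) * (1 - Real.exp (-θ)) :=
      mul_le_mul (by linarith) (by linarith)
        (by linarith [Real.exp_le_one_iff.2 (show -θ * v ≤ 0 by nlinarith [hv.1])]) (by linarith)
    nlinarith

open Set in
/-- Differentiation under the integral sign for a jointly continuous partial derivative. -/
theorem hasDerivAt_integral_of_continuous {p g : ℝ → ℝ → ℝ}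
    (hp : Continuous (Function.uncurry p)) (hg : Continuous (Function.uncurry g))
    (hd : ∀ u ∈ Icc (0 : ℝ) 1, ∀ v ∈ Ioo (0 : ℝ) 1, HasDerivAt (p u) (g u v) v)
    {x v : ℝ} (hx : x ∈ Icc (0 : ℝ) 1) (hv : v ∈ Ioo (0 : ℝ) 1) :
    HasDerivAt (fun w => ∫ u in (0 : ℝ)..x, p u w) (∫ u in (0 : ℝ)..x, g u v) v := by
  obtain ⟨C, hC⟩ := (isCompact_Icc.prod isCompact_Icc : IsCompact
    (Icc (0 : ℝ) 1 ×ˢ Icc (0 : ℝ) 1)).exists_bound_of_continuousOn hg.continuousOn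
  have hsub : ∀ u ∈ uIoc 0 x, u ∈ Icc (0 : ℝ) 1 := by
    intro u hu
    rw [uIoc_of_le hx.1] at hu
    exact ⟨hu.1.le, hu.2.trans hx.2⟩
  have hpw : ∀ w, Continuous fun u => p u w := fun w =>
    hp.comp (by fun_prop : Continuous fun u : ℝ => (u, w))
  have hgw : ∀ w, Continuous fun u => g u w := fun w =>
    hg.comp (by fun_prop : Continuous fun u : ℝ => (u, w))
  exact (intervalIntegral.hasDerivAt_integral_of_dominated_loc_of_deriv_le
    (F := fun w u => p u w) (F' := fun w u => g u w) (bound := fun _ => C)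
    (Ioo_mem_nhds hv.1 hv.2)
    (Filter.Eventually.of_forall fun w => (hpw w).aestronglyMeasurable)
    ((hpw v).intervalIntegrable _ _) (hgw v).aestronglyMeasurable
    (Filter.Eventually.of_forall fun u hu w hw => hC (u, w) ⟨hsub u hu, Ioo_subset_Icc_self hw⟩)
    intervalIntegrable_const
    (Filter.Eventually.of_forall fun u hu w hw => hd u (hsub u hu) w hw)).2

open Set in
/-- The conditional distribution function `Q = ∫₀ᵘ p` satisfies a logistic equation in `v`. -/
theorem hasDerivAt_conditional_cdf {p g : ℝ → ℝ → ℝ} {θ : ℝ}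
    (hp : Continuous (Function.uncurry p)) (hg : Continuous (Function.uncurry g))
    (hpos : ∀ u v, 0 < p u v)
    (hmU : ∀ v ∈ Icc (0 : ℝ) 1, (∫ u in (0 : ℝ)..1, p u v) = 1)
    (hd : ∀ u ∈ Icc (0 : ℝ) 1, ∀ v ∈ Ioo (0 : ℝ) 1, HasDerivAt (p u) (g u v) v)
    (hL : ∀ u ∈ Ioo (0 : ℝ) 1, ∀ v ∈ Ioo (0 : ℝ) 1,
      HasDerivAt (fun u' => g u' v / p u' v) (2 * θ * p u v) u)
    {x v : ℝ} (hx : x ∈ Icc (0 : ℝ) 1) (hv : v ∈ Ioo (0 : ℝ) 1) :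
    HasDerivAt (fun w => ∫ u in (0 : ℝ)..x, p u w)
      (-θ * (∫ u in (0 : ℝ)..x, p u v) * (1 - ∫ u in (0 : ℝ)..x, p u v)) v := by
  have hpv : Continuous fun u => p u v := hp.comp (by fun_prop : Continuous fun u : ℝ => (u, v))
  have hgv : Continuous fun u => g u v := hg.comp (by fun_prop : Continuous fun u : ℝ => (u, v))
  set Q : ℝ → ℝ := fun x => ∫ u in (0 : ℝ)..x, p u v with hQ
  have hQd : ∀ x, HasDerivAt Q (p x v) x := fun x =>
    intervalIntegral.integral_hasDerivAt_right (hpv.intervalIntegrable _ _)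
      (hpv.stronglyMeasurableAtFilter _ _) hpv.continuousAt
  have hQc : Continuous Q := continuous_iff_continuousAt.2 fun x => (hQd x).continuousAt
  have hQ0 : Q 0 = 0 := by simp [hQ]
  have hQ1 : Q 1 = 1 := hmU v (Ioo_subset_Icc_self hv)
  obtain ⟨B, hB⟩ : ∃ B, ∀ u ∈ Icc (0 : ℝ) 1, g u v = p u v * (B + 2 * θ * Q u) := by
    refine ⟨g 0 v / p 0 v, fun u hu => ?_⟩
    have := eq_left_of_hasDerivAt_zero (f := fun u => g u v / p u v - 2 * θ * Q u)
      (Continuous.continuousOn ((hgv.div hpv fun u => (hpos u v).ne').sub (hQc.const_mul _)))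
      (fun u hu => ((hL u hu v hv).sub ((hQd u).const_mul (2 * θ))).congr_deriv (by simp)) u hu
    simp only [hQ0, mul_zero, sub_zero] at this
    rw [← this]
    have := (hpos u v).ne'
    field_simp
    ring
  have hint : ∀ x ∈ Icc (0 : ℝ) 1, (∫ u in (0 : ℝ)..x, g u v) = B * Q x + θ * Q x ^ 2 := by
    intro x hx
    rw [intervalIntegral.integral_eq_sub_of_hasDerivAt (f := fun u => B * Q u + θ * Q u ^ 2)
      (f' := fun u => g u v) (fun u hu => ?_) (hgv.intervalIntegrable _ _)]
    · simp [hQ0]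
    · rw [uIcc_of_le hx.1] at hu
      refine (((hQd u).const_mul B).add (((hQd u).pow 2).const_mul θ)).congr_deriv ?_
      rw [hB u ⟨hu.1, hu.2.trans hx.2⟩]
      push_cast
      ring
  have hBθ : B = -θ := by
    have h1 := hasDerivAt_integral_of_continuous hp hg hd (right_mem_Icc.2 zero_le_one) hv
    have h2 : HasDerivAt (fun w => ∫ u in (0 : ℝ)..1, p u w) 0 v :=
      (hasDerivAt_const v (1 : ℝ)).congr_of_eventuallyEq <| by
        filter_upwards [Icc_mem_nhds hv.1 hv.2] with w hw using hmU w hw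
    have h3 := h1.unique h2
    rw [hint 1 (right_mem_Icc.2 zero_le_one), hQ1] at h3
    linarith
  refine (hasDerivAt_integral_of_continuous hp hg hd hx hv).congr_deriv ?_
  rw [hint x hx, hBθ]
  ring

open Set in
/-- A logistic function on `[0,1]` with prescribed mean `x`. -/
theorem logistic_eq_of_integral_eq {q : ℝ → ℝ} {θ x : ℝ} (hθ : θ ≠ 0)
    (hx : x ∈ Icc (0 : ℝ) 1) (hc : Continuous q)
    (hlt : ∀ v ∈ Icc (0 : ℝ) 1, q v < 1)
    (hq : ∀ v ∈ Ioo (0 : ℝ) 1, HasDerivAt q (-θ * q v * (1 - q v)) v)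
    (hint : (∫ v in (0 : ℝ)..1, q v) = x) {v : ℝ} (hv : v ∈ Icc (0 : ℝ) 1) :
    q v = Real.exp (-θ * v) * (1 - Real.exp (-θ * x)) /
      (1 - Real.exp (-θ) - (1 - Real.exp (-θ * x)) * (1 - Real.exp (-θ * v))) := by
  have hne : ∀ v ∈ Icc (0 : ℝ) 1, 1 - q v ≠ 0 := fun v hv => (sub_pos.2 (hlt v hv)).ne'
  have hodds : ∀ v ∈ Icc (0 : ℝ) 1, Real.exp (θ * v) * (q v / (1 - q v)) = q 0 / (1 - q 0) := by
    intro v hv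
    have := eq_left_of_hasDerivAt_zero (f := fun v => Real.exp (θ * v) * (q v / (1 - q v)))
      (ContinuousOn.mul (by fun_prop) (hc.continuousOn.div (by fun_prop) hne))
      (fun w hw => by
        have hw' := hne w (Ioo_subset_Icc_self hw)
        refine ((((hasDerivAt_id w).const_mul θ).exp).mul
          ((hq w hw).div ((hq w hw).const_sub 1) hw')).congr_deriv ?_
        simp only [id, Pi.div_apply]
        field_simp
        ring) v hv
    simpa using this
  have hlog : Real.log (1 - q 1) - Real.log (1 - q 0) = θ * x := by
    have hI : ∀ w, HasDerivAt (fun w => ∫ v in (0 : ℝ)..w, q v) (q w) w := fun w =>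
      intervalIntegral.integral_hasDerivAt_right (hc.intervalIntegrable _ _)
        (hc.stronglyMeasurableAtFilter _ _) hc.continuousAt
    have := eq_left_of_hasDerivAt_zero
      (f := fun v => Real.log (1 - q v) - θ * ∫ t in (0 : ℝ)..v, q t)
      (ContinuousOn.sub (ContinuousOn.log (by fun_prop) hne) (Continuous.continuousOn
        (continuous_const.mul (continuous_iff_continuousAt.2 fun w => (hI w).continuousAt))))
      (fun w hw => by
        have hw' := hne w (Ioo_subset_Icc_self hw)
        refine ((((hq w hw).const_sub 1).log hw').sub ((hI w).const_mul θ)).congr_deriv ?_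
        field_simp
        ring) 1 (right_mem_Icc.2 zero_le_one)
    simp only [hint, intervalIntegral.integral_same] at this
    linarith
  have h0 := hne 0 (left_mem_Icc.2 zero_le_one)
  have h1 := hne 1 (right_mem_Icc.2 zero_le_one)
  have hend : 1 - q 1 = Real.exp (θ * x) * (1 - q 0) := by
    have h0' := sub_pos.2 (hlt 0 (left_mem_Icc.2 zero_le_one))
    have h1' := sub_pos.2 (hlt 1 (right_mem_Icc.2 zero_le_one))
    rw [← Real.exp_log h1', eq_add_of_sub_eq hlog, Real.exp_add, Real.exp_log h0']
  have hone := hodds 1 (right_mem_Icc.2 zero_le_one)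
  have hvv := hodds v hv
  have hv1 := hne v hv
  have hD := frankDensity_denom_ne_zero hθ hx hv
  have key : ∀ y, Real.exp (-θ * y) = (Real.exp (θ * y))⁻¹ := fun y => by
    rw [← Real.exp_neg]; ring_nf
  have keyone : Real.exp (-θ) = (Real.exp θ)⁻¹ := Real.exp_neg θ
  rw [key x, key v, keyone] at hD ⊢
  rw [mul_one] at hone
  have e1 := Real.exp_pos θ
  have e2 := Real.exp_pos (θ * x)
  have e3 := Real.exp_pos (θ * v)
  generalize Real.exp θ = T at *
  generalize Real.exp (θ * x) = X at *
  generalize Real.exp (θ * v) = V at *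
  have hq1 : q 1 = 1 - X * (1 - q 0) := by linarith
  have hq0 : q 0 * (1 - T⁻¹) = 1 - X⁻¹ := by
    rw [hq1] at hone
    have hX : X * (1 - q 0) ≠ 0 := mul_ne_zero e2.ne' h0
    field_simp at hone ⊢
    rw [sub_sub_cancel] at hone
    field_simp at hone
    linear_combination hone
  rw [eq_div_iff hD]
  have hvv' : V * q v * (1 - q 0) = q 0 * (1 - q v) := by
    field_simp at hvv
    linear_combination hvv
  have : V * (q v * (1 - T⁻¹ - (1 - X⁻¹) * (1 - V⁻¹))) = V * (V⁻¹ * (1 - X⁻¹)) := by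
    rw [← hq0]
    have hVV : V * V⁻¹ = 1 := mul_inv_cancel₀ e3.ne'
    linear_combination (1 - T⁻¹) * hvv' + (q 0 * (1 - T⁻¹) * q v - q 0 * (1 - T⁻¹)) * hVV
  exact mul_left_cancel₀ e3.ne' this

open Set in
/-- The Frank copula is the only solution of the Liouville equation with uniform marginals, for
densities with a jointly continuous partial derivative in the second variable. -/
theorem eq_frankDensity_of_continuous {p g : ℝ → ℝ → ℝ} {θ : ℝ} (hθ : θ ≠ 0)
    (hp : Continuous (Function.uncurry p)) (hg : Continuous (Function.uncurry g))
    (hpos : ∀ u v, 0 < p u v)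
    (hmU : ∀ v ∈ Icc (0 : ℝ) 1, (∫ u in (0 : ℝ)..1, p u v) = 1)
    (hmV : ∀ u ∈ Icc (0 : ℝ) 1, (∫ v in (0 : ℝ)..1, p u v) = 1)
    (hd : ∀ u ∈ Icc (0 : ℝ) 1, ∀ v ∈ Ioo (0 : ℝ) 1, HasDerivAt (p u) (g u v) v)
    (hL : ∀ u ∈ Ioo (0 : ℝ) 1, ∀ v ∈ Ioo (0 : ℝ) 1,
      HasDerivAt (fun u' => g u' v / p u' v) (2 * θ * p u v) u)
    {u v : ℝ} (hu : u ∈ Icc (0 : ℝ) 1) (hv : v ∈ Icc (0 : ℝ) 1) :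
    p u v = frankDensity θ u v := by
  have hpw : ∀ v, Continuous fun u => p u v := fun v =>
    hp.comp (by fun_prop : Continuous fun u : ℝ => (u, v))
  have hcdf : ∀ x ∈ Ioo (0 : ℝ) 1, (∫ u in (0 : ℝ)..x, p u v) =
      Real.exp (-θ * v) * (1 - Real.exp (-θ * x)) /
        (1 - Real.exp (-θ) - (1 - Real.exp (-θ * x)) * (1 - Real.exp (-θ * v))) := by
    intro x hx
    have hx' := Ioo_subset_Icc_self hx
    refine logistic_eq_of_integral_eq (q := fun v => ∫ u in (0 : ℝ)..x, p u v) hθ hx' ?_ ?_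
      (fun w hw => hasDerivAt_conditional_cdf hp hg hpos hmU hd hL hx' hw) ?_ hv
    · exact intervalIntegral.continuous_parametric_intervalIntegral_of_continuous'
        (μ := MeasureTheory.volume) (f := fun v u => p u v) (hp.comp continuous_swap) 0 x
    · intro w hw
      have h1 := intervalIntegral.integral_add_adjacent_intervals
        ((hpw w).intervalIntegrable (μ := MeasureTheory.volume) 0 x) ((hpw w).intervalIntegrable x 1)
      have h2 : 0 < ∫ u in x..1, p u w :=
        intervalIntegral.intervalIntegral_pos_of_pos ((hpw w).intervalIntegrable _ _)
          (fun u => hpos u w) hx.2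
      rw [hmU w hw] at h1
      linarith
    · have hswap := MeasureTheory.intervalIntegral_intervalIntegral_swap (F := p) (a := 0) (b := x)
        (c := 0) (d := 1) ((hp.continuousOn.integrableOn_compact
          (isCompact_uIcc.prod isCompact_uIcc)).mono_set
            (prod_mono uIoc_subset_uIcc uIoc_subset_uIcc))
      rw [← hswap, intervalIntegral.integral_congr (g := fun _ => (1 : ℝ)) fun u hu => ?_]
      · simp
      · rw [uIcc_of_le hx'.1] at hu
        exact hmV u ⟨hu.1, hu.2.trans hx'.2⟩
  have hint : ∀ x ∈ Ioo (0 : ℝ) 1, p x v = frankDensity θ x v := by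
    intro x hx
    have hx' := Ioo_subset_Icc_self hx
    have h1 : HasDerivAt (fun x => ∫ u in (0 : ℝ)..x, p u v) (p x v) x :=
      intervalIntegral.integral_hasDerivAt_right ((hpw v).intervalIntegrable _ _)
        ((hpw v).stronglyMeasurableAtFilter _ _) (hpw v).continuousAt
    have hD := frankDensity_denom_ne_zero hθ hx' hv
    have ha : HasDerivAt (fun x => 1 - Real.exp (-θ * x)) (θ * Real.exp (-θ * x)) x :=
      ((((hasDerivAt_id x).const_mul (-θ)).exp).const_sub 1).congr_deriv (by simp; ring)
    have h2 := ((ha.const_mul (Real.exp (-θ * v))).div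
      ((ha.mul_const (1 - Real.exp (-θ * v))).const_sub (1 - Real.exp (-θ))) hD)
    have h3 := h1.unique (h2.congr_of_eventuallyEq (by
      filter_upwards [Ioo_mem_nhds hx.1 hx.2] with y hy using hcdf y hy))
    rw [h3, frankDensity, mul_add, Real.exp_add]
    congr 1
    ring
  have hcl : Icc (0 : ℝ) 1 = closure (Ioo 0 1) := (closure_Ioo zero_ne_one).symm
  refine (show EqOn (fun x => p x v) (fun x => frankDensity θ x v) (Ioo 0 1) from
    hint).of_subset_closure (t := Icc 0 1) (hpw v).continuousOn ?_ Ioo_subset_Icc_self hcl.le hu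
  unfold frankDensity
  exact ContinuousOn.div (by fun_prop) (by fun_prop)
    fun x hx => pow_ne_zero 2 (frankDensity_denom_ne_zero hθ hx hv)

/-- A copula density whose log-density satisfies the hyperbolic Liouville equation
`∂²/∂u∂v log p = λ p` with `λ ≠ 0` is the Frank copula density with `θ = λ/2`. -/
theorem copula_density_liouville_eq_frank (p : ℝ → ℝ → ℝ) (hp : IsCopulaDensity p)
    (lam : ℝ) (hlam : lam ≠ 0)
    (hLiouville : ∀ u ∈ Set.Ioo (0 : ℝ) 1, ∀ v ∈ Set.Ioo (0 : ℝ) 1,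
      deriv (fun u' => deriv (fun v' => Real.log (p u' v')) v) u = lam * p u v) :
    ∀ u ∈ Set.Icc (0 : ℝ) 1, ∀ v ∈ Set.Icc (0 : ℝ) 1,
      p u v = frankDensity (lam / 2) u v := by
  have hpos := hp.pos
  set S : Set (ℝ × ℝ) := Set.Icc 0 1 ×ˢ Set.Icc 0 1
  have hSu : UniqueDiffOn ℝ S := uniqueDiffOn_Icc_zero_one.prod uniqueDiffOn_Icc_zero_one
  set π : ℝ → ℝ := fun x => max 0 (min 1 x) with hπ
  have hπm : ∀ x, π x ∈ Set.Icc (0 : ℝ) 1 := fun x =>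
    ⟨le_max_left _ _, max_le zero_le_one (min_le_left _ _)⟩
  have hπe : ∀ x ∈ Set.Icc (0 : ℝ) 1, π x = x := fun x hx => by
    simp only [hπ]
    rw [min_eq_right hx.2, max_eq_right hx.1]
  have hπc : Continuous fun z : ℝ × ℝ => (π z.1, π z.2) := by fun_prop
  set g : ℝ × ℝ → ℝ := fun z => fderivWithin ℝ (Function.uncurry p) S z (0, 1)
  have hgc : ContinuousOn g S :=
    (hp.smooth.continuousOn_fderivWithin hSu (by norm_num)).clm_apply continuousOn_const
  have hd : ∀ u ∈ Set.Icc (0 : ℝ) 1, ∀ v ∈ Set.Ioo (0 : ℝ) 1, HasDerivAt (p u) (g (u, v)) v := by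
    intro u hu v hv
    have hz : (u, v) ∈ S := ⟨hu, Set.Ioo_subset_Icc_self hv⟩
    have h1 := ((hp.smooth.differentiableOn (by norm_num)) (u, v) hz).hasFDerivWithinAt
    have h2 : HasDerivWithinAt (fun w : ℝ => (u, w)) (0, 1) (Set.Icc 0 1) v :=
      (hasDerivWithinAt_const v _ u).prodMk (hasDerivWithinAt_id v _)
    exact (h1.comp_hasDerivWithinAt v h2 fun w hw => ⟨hu, hw⟩).hasDerivAt
      (Icc_mem_nhds hv.1 hv.2)
  have hL : ∀ u ∈ Set.Ioo (0 : ℝ) 1, ∀ v ∈ Set.Ioo (0 : ℝ) 1,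
      HasDerivAt (fun u' => g (u', v) / p u' v) (lam * p u v) u := by
    intro u hu v hv
    have hval := hLiouville u hu v hv
    have hne : lam * p u v ≠ 0 := mul_ne_zero hlam
      (hpos u (Set.Ioo_subset_Icc_self hu) v (Set.Ioo_subset_Icc_self hv)).ne'
    have h1 := (differentiableAt_of_deriv_ne_zero (hval.trans_ne hne)).hasDerivAt
    rw [hval] at h1
    refine h1.congr_of_eventuallyEq ?_
    filter_upwards [Icc_mem_nhds hu.1 hu.2] with w hw
    exact ((hd w hw v hv).log (hpos w hw v (Set.Ioo_subset_Icc_self hv)).ne').deriv.symm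
  intro u hu v hv
  have hmain := eq_frankDensity_of_continuous (p := fun u v => p (π u) (π v))
    (g := fun u v => g (π u, π v)) (θ := lam / 2) (by simpa using hlam)
    (hp.smooth.continuousOn.comp_continuous hπc fun z => ⟨hπm _, hπm _⟩)
    (hgc.comp_continuous hπc fun z => ⟨hπm _, hπm _⟩)
    (fun u v => hpos _ (hπm u) _ (hπm v)) ?_ ?_ ?_ ?_ hu hv
  · simpa only [hπe u hu, hπe v hv] using hmain
  · intro v hv
    refine (intervalIntegral.integral_congr fun u hu => ?_).trans (hp.margU v hv)
    rw [Set.uIcc_of_le zero_le_one] at hu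
    simp only [hπe u hu, hπe v hv]
  · intro u hu
    refine (intervalIntegral.integral_congr fun v hv => ?_).trans (hp.margV u hu)
    rw [Set.uIcc_of_le zero_le_one] at hv
    simp only [hπe u hu, hπe v hv]
  · intro u hu v hv
    simp only [hπe u hu, hπe v (Set.Ioo_subset_Icc_self hv)]
    refine (hd u hu v hv).congr_of_eventuallyEq ?_
    filter_upwards [Icc_mem_nhds hv.1 hv.2] with w hw
    rw [hπe w hw]
  · intro u hu v hv
    simp only [hπe u (Set.Ioo_subset_Icc_self hu), hπe v (Set.Ioo_subset_Icc_self hv)]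
    rw [mul_div_cancel₀ lam two_ne_zero]
    refine (hL u hu v hv).congr_of_eventuallyEq ?_
    filter_upwards [Icc_mem_nhds hu.1 hu.2] with w hw
    rw [hπe w hw]
end

section
/- Fix τ ∈ (−1,1). Let P be the set of bivariate copula densities, i.e., twice continuously differentiable functions p : [0,1]² → ℝ with p > 0, ∫₀¹ p(u,v) du = 1 for all v, ∫₀¹ p(u,v) dv = 1 for all u, and satisfying the Kendall's τ constraint K(p) := ∫₀¹∫₀¹∫₀¹∫₀¹ sgn(u−ũ) sgn(v−ṽ) p(u,v) p(ũ,ṽ) du dv dũ dṽ = τ. If p ∈ P minimizes the Shannon information ∫₀¹∫₀¹ p(u,v) log p(u,v) du dv over P, then there exists a real constant λ (the Lagrange multiplier) such that ∂²/∂u∂v log p(u,v) = 8λ · p(u,v) for all (u,v) ∈ (0,1)². -/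
/-- The Kendall's τ functional of a bivariate density on the unit square. -/
noncomputable def kendallTau (p : ℝ → ℝ → ℝ) : ℝ :=
  ∫ u in (0 : ℝ)..1, ∫ v in (0 : ℝ)..1, ∫ u' in (0 : ℝ)..1, ∫ v' in (0 : ℝ)..1,
    Real.sign (u - u') * Real.sign (v - v') * p u v * p u' v'

/-- The Shannon information (negative entropy) of a bivariate density. -/
noncomputable def shannonInfo (p : ℝ → ℝ → ℝ) : ℝ :=
  ∫ u in (0 : ℝ)..1, ∫ v in (0 : ℝ)..1, p u v * Real.log (p u v)

open MeasureTheory Set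

/-- The uniform probability measure on the unit square `(0,1]²`. -/
noncomputable abbrev squareMeasure : Measure (ℝ × ℝ) :=
  (volume.restrict (Ioc (0 : ℝ) 1)).prod (volume.restrict (Ioc (0 : ℝ) 1))

lemma squareMeasure_eq_restrict :
    squareMeasure = volume.restrict (Ioc (0 : ℝ) 1 ×ˢ Ioc (0 : ℝ) 1) := by
  rw [squareMeasure, Measure.prod_restrict, ← Measure.volume_eq_prod]

lemma ContinuousOn.integrable_squareMeasure {f : ℝ × ℝ → ℝ}
    (hf : ContinuousOn f (Icc 0 1 ×ˢ Icc 0 1)) : Integrable f squareMeasure := by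
  rw [squareMeasure_eq_restrict]
  exact (hf.integrableOn_compact (isCompact_Icc.prod isCompact_Icc)).mono_set
    (prod_mono Ioc_subset_Icc_self Ioc_subset_Icc_self)

lemma ae_squareMeasure_of_forall {P : ℝ × ℝ → Prop}
    (h : ∀ z ∈ Ioc (0 : ℝ) 1 ×ˢ Ioc (0 : ℝ) 1, P z) : ∀ᵐ z ∂squareMeasure, P z := by
  rw [squareMeasure_eq_restrict]
  exact ae_restrict_of_forall_mem (measurableSet_Ioc.prod measurableSet_Ioc) h

lemma integral_squareMeasure {f : ℝ × ℝ → ℝ} (hf : Integrable f squareMeasure) :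
    ∫ z, f z ∂squareMeasure = ∫ u in (0 : ℝ)..1, ∫ v in (0 : ℝ)..1, f (u, v) := by
  simp_rw [intervalIntegral.integral_of_le zero_le_one]
  exact integral_prod _ hf

lemma integral_squareMeasure_pos {f : ℝ × ℝ → ℝ} (hf : Integrable f squareMeasure)
    (h0 : ∀ z ∈ Ioc (0 : ℝ) 1 ×ˢ Ioc (0 : ℝ) 1, 0 ≤ f z) {α β γ δ : ℝ} (hαβ : α < β) (hγδ : γ < δ)
    (hα : 0 ≤ α) (hβ : β ≤ 1) (hγ : 0 ≤ γ) (hδ : δ ≤ 1)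
    (hpos : ∀ z ∈ Ioo α β ×ˢ Ioo γ δ, 0 < f z) : 0 < ∫ z, f z ∂squareMeasure := by
  rw [integral_pos_iff_support_of_nonneg_ae (ae_squareMeasure_of_forall h0) hf]
  have hsub : Ioo α β ×ˢ Ioo γ δ ⊆ Function.support f := fun z hz => (hpos z hz).ne'
  refine lt_of_lt_of_le ?_ (measure_mono hsub)
  rw [squareMeasure, Measure.prod_prod, Measure.restrict_apply measurableSet_Ioo,
    Measure.restrict_apply measurableSet_Ioo,
    inter_eq_left.2 (Ioo_subset_Ioc_self.trans (Ioc_subset_Ioc hα hβ)),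
    inter_eq_left.2 (Ioo_subset_Ioc_self.trans (Ioc_subset_Ioc hγ hδ))]
  simp [hαβ, hγδ]

lemma integral_squareMeasure_eq_of_vanishing {f : ℝ × ℝ → ℝ} {α β γ δ : ℝ}
    (hαβ : α ≤ β) (hγδ : γ ≤ δ) (hα : 0 ≤ α) (hβ : β ≤ 1) (hγ : 0 ≤ γ) (hδ : δ ≤ 1)
    (hf : ContinuousOn f (Icc α β ×ˢ Icc γ δ))
    (h0 : ∀ z, z ∉ Ioc α β ×ˢ Ioc γ δ → f z = 0) :
    ∫ z, f z ∂squareMeasure = ∫ u in α..β, ∫ v in γ..δ, f (u, v) := by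
  simp_rw [intervalIntegral.integral_of_le hαβ, intervalIntegral.integral_of_le hγδ]
  rw [squareMeasure_eq_restrict, setIntegral_eq_of_subset_of_forall_sdiff_eq_zero
    (measurableSet_Ioc.prod measurableSet_Ioc)
    (prod_mono (Ioc_subset_Ioc hα hβ) (Ioc_subset_Ioc hγ hδ)) (fun z hz => h0 z hz.2),
    Measure.volume_eq_prod]
  refine setIntegral_prod f ?_
  rw [← Measure.volume_eq_prod]
  exact (hf.integrableOn_compact (isCompact_Icc.prod isCompact_Icc)).mono_set
    (prod_mono Ioc_subset_Icc_self Ioc_subset_Icc_self)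

lemma integral_integral_mul_deriv_mul_deriv {g g₁ g₂ : ℝ → ℝ → ℝ} {a b : ℝ → ℝ} {α β γ δ : ℝ}
    (hαβ : α ≤ β) (hγδ : γ ≤ δ) (ha : ContDiff ℝ 1 a) (hb : ContDiff ℝ 1 b)
    (haα : a α = 0) (haβ : a β = 0) (hbγ : b γ = 0) (hbδ : b δ = 0)
    (hg₁ : ∀ u ∈ Icc α β, ∀ v ∈ Icc γ δ, HasDerivAt (fun v' => g u v') (g₁ u v) v)
    (hg₂ : ∀ u ∈ Icc α β, ∀ v ∈ Icc γ δ, HasDerivAt (fun u' => g₁ u' v) (g₂ u v) u)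
    (hc₁ : ContinuousOn (Function.uncurry g₁) (Icc α β ×ˢ Icc γ δ))
    (hc₂ : ContinuousOn (Function.uncurry g₂) (Icc α β ×ˢ Icc γ δ)) :
    ∫ u in α..β, ∫ v in γ..δ, g u v * (deriv a u * deriv b v) =
      ∫ u in α..β, ∫ v in γ..δ, g₂ u v * (a u * b v) := by
  have hda : Continuous (deriv a) := ha.continuous_deriv le_rfl
  have hdb : Continuous (deriv b) := hb.continuous_deriv le_rfl
  have hA : ∀ x, HasDerivAt a (deriv a x) x := fun x =>
    (ha.differentiable one_ne_zero x).hasDerivAt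
  have hB : ∀ x, HasDerivAt b (deriv b x) x := fun x =>
    (hb.differentiable one_ne_zero x).hasDerivAt
  have hsec₁ : ∀ u ∈ Icc α β, ContinuousOn (g₁ u) (Icc γ δ) := fun u hu =>
    hc₁.comp (f := fun v => (u, v)) (by fun_prop) (fun v hv => ⟨hu, hv⟩)
  have hsec₂ : ∀ v ∈ Icc γ δ, ContinuousOn (fun u => g₂ u v) (Icc α β) := fun v hv =>
    hc₂.comp (f := fun u => (u, v)) (by fun_prop) (fun u hu => ⟨hu, hv⟩)
  have swap : ∀ F : ℝ → ℝ → ℝ, ContinuousOn (Function.uncurry F) (Icc α β ×ˢ Icc γ δ) →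
      ∫ u in α..β, ∫ v in γ..δ, F u v = ∫ v in γ..δ, ∫ u in α..β, F u v := by
    intro F hF
    refine intervalIntegral_intervalIntegral_swap ?_
    rw [uIoc_of_le hαβ, uIoc_of_le hγδ]
    exact (hF.integrableOn_compact (isCompact_Icc.prod isCompact_Icc)).mono_set
      (prod_mono Ioc_subset_Icc_self Ioc_subset_Icc_self)
  have step₁ : ∀ u ∈ uIcc α β, ∫ v in γ..δ, g u v * (deriv a u * deriv b v) =
      ∫ v in γ..δ, -(g₁ u v * (deriv a u * b v)) := by
    intro u hu
    rw [uIcc_of_le hαβ] at hu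
    have h := intervalIntegral.integral_mul_deriv_eq_deriv_mul (a := γ) (b := δ)
      (u := g u) (u' := g₁ u) (v := fun v => deriv a u * b v) (v' := fun v => deriv a u * deriv b v)
      (by rw [uIcc_of_le hγδ]; exact hg₁ u hu) (fun v _ => (hB v).const_mul _)
      (by apply ContinuousOn.intervalIntegrable; rw [uIcc_of_le hγδ]; exact hsec₁ u hu)
      (by apply Continuous.intervalIntegrable; fun_prop)
    rw [h, intervalIntegral.integral_neg]
    simp [hbγ, hbδ]
  have step₂ : ∀ v ∈ uIcc γ δ, ∫ u in α..β, -(g₁ u v * (deriv a u * b v)) =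
      ∫ u in α..β, g₂ u v * (a u * b v) := by
    intro v hv
    rw [uIcc_of_le hγδ] at hv
    have h := intervalIntegral.integral_mul_deriv_eq_deriv_mul (a := α) (b := β)
      (u := fun u => g₁ u v) (u' := fun u => g₂ u v) (v := fun u => a u * b v)
      (v' := fun u => deriv a u * b v)
      (by rw [uIcc_of_le hαβ]; exact fun u hu => hg₂ u hu v hv) (fun u _ => (hA u).mul_const _)
      (by apply ContinuousOn.intervalIntegrable; rw [uIcc_of_le hαβ]; exact hsec₂ v hv)
      (by apply Continuous.intervalIntegrable; fun_prop)
    rw [intervalIntegral.integral_neg, h]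
    simp [haα, haβ]
  have hbc := hb.continuous
  have hac := ha.continuous
  rw [intervalIntegral.integral_congr step₁, swap, intervalIntegral.integral_congr step₂, swap]
  · exact hc₂.mul (by fun_prop)
  · exact (hc₁.mul (by fun_prop)).neg

/-- The bilinear form whose diagonal is Kendall's τ. -/
noncomputable def kendallForm (f g : ℝ × ℝ → ℝ) : ℝ :=
  ∫ w, Real.sign (w.1.1 - w.2.1) * Real.sign (w.1.2 - w.2.2) * (f w.1 * g w.2)
    ∂squareMeasure.prod squareMeasure

lemma measurable_real_sign : Measurable Real.sign := by
  unfold Real.sign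
  exact Measurable.ite measurableSet_Iio measurable_const
    (Measurable.ite measurableSet_Ioi measurable_const measurable_const)

lemma abs_real_sign_le_one (x : ℝ) : |Real.sign x| ≤ 1 := by
  rcases Real.sign_apply_eq x with h | h | h <;> simp [h]

lemma integrable_kendallForm {f g : ℝ × ℝ → ℝ} (hf : Integrable f squareMeasure)
    (hg : Integrable g squareMeasure) :
    Integrable (fun w : (ℝ × ℝ) × (ℝ × ℝ) =>
      Real.sign (w.1.1 - w.2.1) * Real.sign (w.1.2 - w.2.2) * (f w.1 * g w.2))
      (squareMeasure.prod squareMeasure) := by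
  refine (hf.mul_prod hg).bdd_mul (c := 1) ?_ (Filter.Eventually.of_forall fun w => ?_)
  · exact ((measurable_real_sign.comp (by fun_prop)).mul
      (measurable_real_sign.comp (by fun_prop))).aestronglyMeasurable
  · rw [Real.norm_eq_abs, abs_mul]
    exact mul_le_one₀ (abs_real_sign_le_one _) (abs_nonneg _) (abs_real_sign_le_one _)

lemma kendallForm_comm (f g : ℝ × ℝ → ℝ) : kendallForm f g = kendallForm g f := by
  unfold kendallForm
  rw [← integral_prod_swap]
  congr 1 with w
  have h (x y : ℝ) : Real.sign (x - y) = -Real.sign (y - x) := by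
    rw [← Real.sign_neg, neg_sub]
  simp only [Prod.fst_swap, Prod.snd_swap]
  rw [h w.2.1, h w.2.2]
  ring

lemma kendallForm_add_right {f g h : ℝ × ℝ → ℝ} (hf : Integrable f squareMeasure)
    (hg : Integrable g squareMeasure) (hh : Integrable h squareMeasure) :
    kendallForm f (g + h) = kendallForm f g + kendallForm f h := by
  unfold kendallForm
  rw [← integral_add (integrable_kendallForm hf hg) (integrable_kendallForm hf hh)]
  congr 1 with w
  simp only [Pi.add_apply]
  ring

lemma kendallForm_smul_right (c : ℝ) (f g : ℝ × ℝ → ℝ) :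
    kendallForm f (c • g) = c * kendallForm f g := by
  unfold kendallForm
  rw [← integral_const_mul]
  congr 1 with w
  simp only [Pi.smul_apply, smul_eq_mul]
  ring

lemma kendallForm_smul_left (c : ℝ) (f g : ℝ × ℝ → ℝ) :
    kendallForm (c • f) g = c * kendallForm f g := by
  rw [kendallForm_comm, kendallForm_smul_right, kendallForm_comm]

lemma kendallForm_add_self {f g : ℝ × ℝ → ℝ} (hf : Integrable f squareMeasure)
    (hg : Integrable g squareMeasure) :
    kendallForm (f + g) (f + g) = kendallForm f f + 2 * kendallForm f g + kendallForm g g := by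
  rw [kendallForm_add_right (hf.add hg) hf hg, kendallForm_comm _ f, kendallForm_comm _ g,
    kendallForm_add_right hf hf hg, kendallForm_add_right hg hf hg, kendallForm_comm g f]
  ring

lemma kendallForm_eq_integral {f g : ℝ × ℝ → ℝ} (hf : Integrable f squareMeasure)
    (hg : Integrable g squareMeasure) :
    kendallForm f g = ∫ z, f z * (∫ z', Real.sign (z.1 - z'.1) * Real.sign (z.2 - z'.2) * g z'
      ∂squareMeasure) ∂squareMeasure := by
  unfold kendallForm
  rw [integral_prod _ (integrable_kendallForm hf hg)]
  congr 1 with z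
  rw [← integral_const_mul]
  congr 1 with z'
  ring

lemma kendallTau_eq_kendallForm {p : ℝ → ℝ → ℝ}
    (hp : Integrable (Function.uncurry p) squareMeasure) :
    kendallTau p = kendallForm (Function.uncurry p) (Function.uncurry p) := by
  have h := (integrable_kendallForm hp hp).integral_prod_left
  unfold kendallForm kendallTau
  rw [integral_prod _ (integrable_kendallForm hp hp), integral_squareMeasure h]
  congr 1 with u
  congr 1 with v
  rw [integral_squareMeasure]
  · simp [Function.uncurry, mul_assoc]
  · refine (hp.const_mul (p u v)).bdd_mul (c := 1) ?_ (Filter.Eventually.of_forall fun w => ?_)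
    · exact ((measurable_real_sign.comp (by fun_prop)).mul
        (measurable_real_sign.comp (by fun_prop))).aestronglyMeasurable
    · rw [Real.norm_eq_abs, abs_mul]
      exact mul_le_one₀ (abs_real_sign_le_one _) (abs_nonneg _) (abs_real_sign_le_one _)

lemma integral_sign_sub_mul_deriv {a : ℝ → ℝ} (ha : ContDiff ℝ 1 a) (h0 : a 0 = 0) (h1 : a 1 = 0)
    {u : ℝ} (hu : u ∈ Icc (0 : ℝ) 1) :
    ∫ x in Ioc (0 : ℝ) 1, Real.sign (u - x) * deriv a x = 2 * a u := by
  have hda : Continuous (deriv a) := ha.continuous_deriv le_rfl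
  have hint (x y : ℝ) : ∫ t in x..y, deriv a t = a y - a x :=
    intervalIntegral.integral_deriv_eq_sub (fun t _ => ha.differentiable one_ne_zero t)
      (hda.intervalIntegrable _ _)
  have hI (x y : ℝ) : IntervalIntegrable (fun t => Real.sign (u - t) * deriv a t) volume x y := by
    have hm (s : Set ℝ) : AEStronglyMeasurable (fun t => Real.sign (u - t)) (volume.restrict s) :=
      (measurable_real_sign.comp (by fun_prop)).aestronglyMeasurable
    have hb (s : Set ℝ) : ∀ᵐ t ∂volume.restrict s, ‖Real.sign (u - t)‖ ≤ 1 :=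
      Filter.Eventually.of_forall fun t => abs_real_sign_le_one _
    have := hda.intervalIntegrable (μ := volume) x y
    exact ⟨this.1.bdd_mul (hm _) (hb _), this.2.bdd_mul (hm _) (hb _)⟩
  have hl : ∫ t in (0 : ℝ)..u, Real.sign (u - t) * deriv a t = ∫ t in (0 : ℝ)..u, deriv a t := by
    rw [intervalIntegral.integral_of_le hu.1, intervalIntegral.integral_of_le hu.1,
      integral_Ioc_eq_integral_Ioo, integral_Ioc_eq_integral_Ioo]
    refine setIntegral_congr_fun measurableSet_Ioo fun t ht => ?_
    simp only [Real.sign_of_pos (sub_pos.2 ht.2), one_mul]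
  have hr : ∫ t in u..1, Real.sign (u - t) * deriv a t = ∫ t in u..1, -deriv a t := by
    rw [intervalIntegral.integral_of_le hu.2, intervalIntegral.integral_of_le hu.2]
    refine setIntegral_congr_fun measurableSet_Ioc fun t ht => ?_
    simp only [Real.sign_of_neg (sub_neg.2 ht.1), neg_one_mul]
  rw [← intervalIntegral.integral_of_le zero_le_one,
    ← intervalIntegral.integral_add_adjacent_intervals (hI 0 u) (hI u 1), hl, hr,
    intervalIntegral.integral_neg, hint, hint, h0, h1]
  ring

lemma kendallForm_deriv_mul_deriv {f : ℝ × ℝ → ℝ} (hf : Integrable f squareMeasure)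
    {a b : ℝ → ℝ} (ha : ContDiff ℝ 1 a) (hb : ContDiff ℝ 1 b)
    (ha0 : a 0 = 0) (ha1 : a 1 = 0) (hb0 : b 0 = 0) (hb1 : b 1 = 0) :
    kendallForm f (fun z => deriv a z.1 * deriv b z.2) =
      4 * ∫ z, f z * (a z.1 * b z.2) ∂squareMeasure := by
  have hda : Continuous (deriv a) := ha.continuous_deriv le_rfl
  have hdb : Continuous (deriv b) := hb.continuous_deriv le_rfl
  rw [kendallForm_eq_integral hf
    (ContinuousOn.integrable_squareMeasure (Continuous.continuousOn (by fun_prop))),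
    ← integral_const_mul]
  refine integral_congr_ae (ae_squareMeasure_of_forall fun z hz => ?_)
  have h := integral_prod_mul (μ := volume.restrict (Ioc (0 : ℝ) 1))
    (ν := volume.restrict (Ioc (0 : ℝ) 1)) (fun x => Real.sign (z.1 - x) * deriv a x)
    (fun y => Real.sign (z.2 - y) * deriv b y)
  rw [integral_sign_sub_mul_deriv ha ha0 ha1 (Ioc_subset_Icc_self hz.1),
    integral_sign_sub_mul_deriv hb hb0 hb1 (Ioc_subset_Icc_self hz.2)] at h
  have h' : ∫ z' : ℝ × ℝ, Real.sign (z.1 - z'.1) * Real.sign (z.2 - z'.2) *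
      (deriv a z'.1 * deriv b z'.2) ∂squareMeasure = 2 * a z.1 * (2 * b z.2) := by
    rw [← h]
    congr 1 with z'
    ring
  simp only [h']
  ring

lemma integral_deriv_mul_deriv_mul_eq_zero {a b : ℝ → ℝ} (ha : ContDiff ℝ 1 a)
    (ha0 : a 0 = 0) (ha1 : a 1 = 0) :
    ∫ z, deriv a z.1 * deriv b z.2 * (a z.1 * b z.2) ∂squareMeasure = 0 := by
  have hda : Continuous (deriv a) := ha.continuous_deriv le_rfl
  have hA : ∀ x, HasDerivAt a (deriv a x) x := fun x =>
    (ha.differentiable one_ne_zero x).hasDerivAt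
  have h := integral_prod_mul (μ := volume.restrict (Ioc (0 : ℝ) 1))
    (ν := volume.restrict (Ioc (0 : ℝ) 1)) (fun x => deriv a x * a x)
    (fun y => deriv b y * b y)
  have h' : ∫ x in Ioc (0 : ℝ) 1, deriv a x * a x = 0 := by
    have hac := ha.continuous
    rw [← intervalIntegral.integral_of_le zero_le_one,
      intervalIntegral.integral_eq_sub_of_hasDerivAt (f := fun x => a x ^ 2 / 2)
        (fun x _ => by
          refine (((hA x).pow 2).div_const 2).congr_deriv ?_
          push_cast
          ring)
        (Continuous.intervalIntegrable (by fun_prop) _ _)]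
    simp [ha0, ha1]
  rw [h', zero_mul] at h
  rw [← h]
  congr 1 with z
  ring

/-- `C³` functions on the line vanishing at the endpoints of the unit interval. -/
structure VanishesAtEndpoints (a : ℝ → ℝ) : Prop where
  smooth : ContDiff ℝ 3 a
  zero : a 0 = 0
  one : a 1 = 0

namespace VanishesAtEndpoints

variable {a : ℝ → ℝ}

lemma contDiff_one (ha : VanishesAtEndpoints a) : ContDiff ℝ 1 a :=
  ha.smooth.of_le (by norm_num)

lemma contDiff_deriv (ha : VanishesAtEndpoints a) : ContDiff ℝ 2 (deriv a) :=
  ContDiff.deriv' (n := 2) (ha.smooth.of_le (by norm_num))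

lemma integral_deriv (ha : VanishesAtEndpoints a) : ∫ t in (0 : ℝ)..1, deriv a t = 0 := by
  rw [intervalIntegral.integral_deriv_eq_sub
    (fun t _ => ha.contDiff_one.differentiable one_ne_zero t)
    (ha.contDiff_deriv.continuous.intervalIntegrable _ _), ha.zero, ha.one, sub_zero]

end VanishesAtEndpoints

/-- The perturbation direction `a'(u) b'(v)`, which has vanishing marginals when `a`, `b` vanish
at the endpoints. -/
noncomputable def direction (a b : ℝ → ℝ) (z : ℝ × ℝ) : ℝ := deriv a z.1 * deriv b z.2

lemma contDiff_direction {a b : ℝ → ℝ} (ha : VanishesAtEndpoints a)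
    (hb : VanishesAtEndpoints b) : ContDiff ℝ 2 (direction a b) :=
  (ha.contDiff_deriv.comp contDiff_fst).mul (hb.contDiff_deriv.comp contDiff_snd)

lemma integral_direction {a b : ℝ → ℝ} (ha : VanishesAtEndpoints a) :
    ∫ z, direction a b z ∂squareMeasure = 0 := by
  have h := integral_prod_mul (μ := volume.restrict (Ioc (0 : ℝ) 1))
    (ν := volume.restrict (Ioc (0 : ℝ) 1)) (deriv a) (deriv b)
  rw [← intervalIntegral.integral_of_le zero_le_one, ha.integral_deriv, zero_mul] at h
  exact h

lemma IsCopulaDensity.add_direction {p : ℝ → ℝ → ℝ} (hp : IsCopulaDensity p) {a b : ℝ → ℝ}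
    (ha : VanishesAtEndpoints a) (hb : VanishesAtEndpoints b) {a₂ b₂ : ℝ → ℝ}
    (ha₂ : VanishesAtEndpoints a₂) (hb₂ : VanishesAtEndpoints b₂) (s t : ℝ)
    (hpos : ∀ z ∈ Icc (0 : ℝ) 1 ×ˢ Icc (0 : ℝ) 1,
      0 < p z.1 z.2 + (s * direction a b z + t * direction a₂ b₂ z)) :
    IsCopulaDensity
      (fun u v => p u v + (s * direction a b (u, v) + t * direction a₂ b₂ (u, v))) where
  smooth := hp.smooth.add
    ((contDiff_const.mul (contDiff_direction ha hb)).add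
      (contDiff_const.mul (contDiff_direction ha₂ hb₂))).contDiffOn
  pos u hu v hv := hpos (u, v) ⟨hu, hv⟩
  margU v hv := by
    have h₁ := ha.contDiff_deriv.continuous
    have h₂ := ha₂.contDiff_deriv.continuous
    have hpc : ContinuousOn (fun u => p u v) (Icc 0 1) :=
      hp.smooth.continuousOn.comp (f := fun u => (u, v)) (by fun_prop) (fun u hu => ⟨hu, hv⟩)
    simp only [direction]
    rw [intervalIntegral.integral_add (hpc.intervalIntegrable_of_Icc zero_le_one)
        (Continuous.intervalIntegrable (by fun_prop) _ _), hp.margU v hv,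
      intervalIntegral.integral_add (Continuous.intervalIntegrable (by fun_prop) _ _)
        (Continuous.intervalIntegrable (by fun_prop) _ _)]
    simp [ha.integral_deriv, ha₂.integral_deriv]
  margV u hu := by
    have h₁ := hb.contDiff_deriv.continuous
    have h₂ := hb₂.contDiff_deriv.continuous
    have hpc : ContinuousOn (fun v => p u v) (Icc 0 1) :=
      hp.smooth.continuousOn.comp (f := fun v => (u, v)) (by fun_prop) (fun v hv => ⟨hu, hv⟩)
    simp only [direction]
    rw [intervalIntegral.integral_add (hpc.intervalIntegrable_of_Icc zero_le_one)
        (Continuous.intervalIntegrable (by fun_prop) _ _), hp.margV u hu,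
      intervalIntegral.integral_add (Continuous.intervalIntegrable (by fun_prop) _ _)
        (Continuous.intervalIntegrable (by fun_prop) _ _)]
    simp [hb.integral_deriv, hb₂.integral_deriv]

lemma integrable_direction {a b : ℝ → ℝ} (ha : VanishesAtEndpoints a)
    (hb : VanishesAtEndpoints b) : Integrable (direction a b) squareMeasure :=
  (contDiff_direction ha hb).continuous.continuousOn.integrable_squareMeasure

lemma kendallForm_direction {f : ℝ × ℝ → ℝ} (hf : Integrable f squareMeasure) {a b : ℝ → ℝ}
    (ha : VanishesAtEndpoints a) (hb : VanishesAtEndpoints b) :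
    kendallForm f (direction a b) = 4 * ∫ z, f z * (a z.1 * b z.2) ∂squareMeasure :=
  kendallForm_deriv_mul_deriv hf ha.contDiff_one hb.contDiff_one ha.zero ha.one hb.zero hb.one

lemma kendallForm_direction_self {a b : ℝ → ℝ} (ha : VanishesAtEndpoints a)
    (hb : VanishesAtEndpoints b) : kendallForm (direction a b) (direction a b) = 0 := by
  rw [kendallForm_direction (integrable_direction ha hb) ha hb]
  simp only [direction]
  rw [integral_deriv_mul_deriv_mul_eq_zero ha.contDiff_one ha.zero ha.one, mul_zero]

lemma kendallTau_add_direction {p : ℝ → ℝ → ℝ} (hp : IsCopulaDensity p) {a b : ℝ → ℝ}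
    (ha : VanishesAtEndpoints a) (hb : VanishesAtEndpoints b) {a₂ b₂ : ℝ → ℝ}
    (ha₂ : VanishesAtEndpoints a₂) (hb₂ : VanishesAtEndpoints b₂) (s t : ℝ) :
    kendallTau (fun u v => p u v + (s * direction a b (u, v) + t * direction a₂ b₂ (u, v))) =
      kendallTau p + 8 * (s * ∫ z, p z.1 z.2 * (a z.1 * b z.2) ∂squareMeasure) +
        8 * (t * ∫ z, p z.1 z.2 * (a₂ z.1 * b₂ z.2) ∂squareMeasure) +
        2 * s * t * kendallForm (direction a b) (direction a₂ b₂) := by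
  have hP : Integrable (Function.uncurry p) squareMeasure :=
    hp.smooth.continuousOn.integrable_squareMeasure
  have h₁ := integrable_direction ha hb
  have h₂ := integrable_direction ha₂ hb₂
  have h₁' := h₁.smul s
  have h₂' := h₂.smul t
  have hQ : Function.uncurry
      (fun u v => p u v + (s * direction a b (u, v) + t * direction a₂ b₂ (u, v))) =
      Function.uncurry p + (s • direction a b + t • direction a₂ b₂) := by
    ext z
    simp [Function.uncurry]
  rw [kendallTau_eq_kendallForm (by rw [hQ]; exact hP.add (h₁'.add h₂')), hQ,
    kendallTau_eq_kendallForm hP, kendallForm_add_self hP (h₁'.add h₂'),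
    kendallForm_add_self h₁' h₂', kendallForm_add_right hP h₁' h₂']
  simp only [kendallForm_smul_right, kendallForm_smul_left]
  rw [kendallForm_direction_self ha hb, kendallForm_direction_self ha₂ hb₂,
    kendallForm_direction hP ha hb, kendallForm_direction hP ha₂ hb₂]
  simp only [Function.uncurry]
  ring

lemma mul_log_le_of_pos {x y : ℝ} (hx : 0 < x) (hy : 0 < y) :
    y * Real.log y ≤ x * Real.log x + (Real.log x * (y - x) + (y - x) + (y - x) ^ 2 / x) := by
  have h := Real.log_le_sub_one_of_pos (div_pos hy hx)
  rw [Real.log_div hy.ne' hx.ne'] at h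
  have h' := mul_le_mul_of_nonneg_left h hy.le
  have : y * (y / x - 1) = (y - x) + (y - x) ^ 2 / x := by
    field_simp
    ring
  linarith

lemma IsCopulaDensity.continuousOn_log {p : ℝ → ℝ → ℝ} (hp : IsCopulaDensity p) :
    ContinuousOn (fun z : ℝ × ℝ => Real.log (p z.1 z.2)) (Icc 0 1 ×ˢ Icc 0 1) :=
  hp.smooth.continuousOn.log fun z hz => (hp.pos z.1 hz.1 z.2 hz.2).ne'

lemma shannonInfo_eq_integral {p : ℝ → ℝ → ℝ} (hp : IsCopulaDensity p) :
    shannonInfo p = ∫ z, p z.1 z.2 * Real.log (p z.1 z.2) ∂squareMeasure := by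
  have h : ContinuousOn (fun z : ℝ × ℝ => p z.1 z.2 * Real.log (p z.1 z.2))
      (Icc 0 1 ×ˢ Icc 0 1) := hp.smooth.continuousOn.mul hp.continuousOn_log
  rw [integral_squareMeasure h.integrable_squareMeasure, shannonInfo]

lemma shannonInfo_add_direction_le {p : ℝ → ℝ → ℝ} (hp : IsCopulaDensity p) {a b : ℝ → ℝ}
    (ha : VanishesAtEndpoints a) (hb : VanishesAtEndpoints b) {a₂ b₂ : ℝ → ℝ}
    (ha₂ : VanishesAtEndpoints a₂) (hb₂ : VanishesAtEndpoints b₂) : ∃ M N R : ℝ, ∀ s t : ℝ,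
      IsCopulaDensity
        (fun u v => p u v + (s * direction a b (u, v) + t * direction a₂ b₂ (u, v))) →
      shannonInfo (fun u v => p u v + (s * direction a b (u, v) + t * direction a₂ b₂ (u, v))) ≤
        shannonInfo p + (s * ∫ z, Real.log (p z.1 z.2) * direction a b z ∂squareMeasure) +
          (t * ∫ z, Real.log (p z.1 z.2) * direction a₂ b₂ z ∂squareMeasure) +
          (s ^ 2 * M + s * t * N + t ^ 2 * R) := by
  have hpc : ContinuousOn (fun z : ℝ × ℝ => p z.1 z.2) (Icc 0 1 ×ˢ Icc 0 1) :=
    hp.smooth.continuousOn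
  have hp0 : ∀ z ∈ Icc (0 : ℝ) 1 ×ˢ Icc (0 : ℝ) 1, p z.1 z.2 ≠ 0 :=
    fun z hz => (hp.pos z.1 hz.1 z.2 hz.2).ne'
  have hl := hp.continuousOn_log
  have hd := (contDiff_direction ha hb).continuous.continuousOn (s := Icc 0 1 ×ˢ Icc 0 1)
  have hd₂ := (contDiff_direction ha₂ hb₂).continuous.continuousOn (s := Icc 0 1 ×ˢ Icc 0 1)
  refine ⟨∫ z, direction a b z ^ 2 / p z.1 z.2 ∂squareMeasure,
    ∫ z, 2 * (direction a b z * direction a₂ b₂ z) / p z.1 z.2 ∂squareMeasure,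
    ∫ z, direction a₂ b₂ z ^ 2 / p z.1 z.2 ∂squareMeasure, fun s t hq => ?_⟩
  have i₀ : Integrable (fun z : ℝ × ℝ => p z.1 z.2 * Real.log (p z.1 z.2)) squareMeasure :=
    (hpc.mul hl).integrable_squareMeasure
  have i₁ : Integrable (fun z => Real.log (p z.1 z.2) * direction a b z) squareMeasure :=
    (hl.mul hd).integrable_squareMeasure
  have i₂ : Integrable (fun z => Real.log (p z.1 z.2) * direction a₂ b₂ z) squareMeasure :=
    (hl.mul hd₂).integrable_squareMeasure
  have i₃ := integrable_direction ha hb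
  have i₄ := integrable_direction ha₂ hb₂
  have i₅ : Integrable (fun z => direction a b z ^ 2 / p z.1 z.2) squareMeasure :=
    ((hd.pow 2).div hpc hp0).integrable_squareMeasure
  have i₆ : Integrable (fun z => 2 * (direction a b z * direction a₂ b₂ z) / p z.1 z.2)
      squareMeasure := ((continuousOn_const.mul (hd.mul hd₂)).div hpc hp0).integrable_squareMeasure
  have i₇ : Integrable (fun z => direction a₂ b₂ z ^ 2 / p z.1 z.2) squareMeasure :=
    ((hd₂.pow 2).div hpc hp0).integrable_squareMeasure
  have j₀ := (i₀.add (i₁.const_mul s)).add (i₂.const_mul t)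
  have j₁ := (i₃.const_mul s).add (i₄.const_mul t)
  have j₂ := ((i₅.const_mul (s ^ 2)).add (i₆.const_mul (s * t))).add (i₇.const_mul (t ^ 2))
  have iq := (hq.smooth.continuousOn.mul hq.continuousOn_log).integrable_squareMeasure
  have key := integral_mono_ae iq ((j₀.add j₁).add j₂) (ae_squareMeasure_of_forall fun z hz => by
      have hz' := prod_mono Ioc_subset_Icc_self Ioc_subset_Icc_self hz
      refine (mul_log_le_of_pos (hp.pos _ hz'.1 _ hz'.2) (hq.pos _ hz'.1 _ hz'.2)).trans
        (le_of_eq ?_)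
      simp only [Pi.add_apply, Prod.mk.eta]
      have := hp0 z hz'
      field_simp
      ring)
  rw [shannonInfo_eq_integral hq]
  refine key.trans (le_of_eq ?_)
  rw [integral_add' (j₀.add j₁) j₂, integral_add' j₀ j₁,
    integral_add' (i₀.add (i₁.const_mul s)) (i₂.const_mul t), integral_add' i₀ (i₁.const_mul s),
    integral_add' (i₃.const_mul s) (i₄.const_mul t),
    integral_add' ((i₅.const_mul (s ^ 2)).add (i₆.const_mul (s * t))) (i₇.const_mul (t ^ 2)),
    integral_add' (i₅.const_mul (s ^ 2)) (i₆.const_mul (s * t))]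
  simp only [integral_const_mul]
  rw [integral_direction ha, integral_direction ha₂, shannonInfo_eq_integral hp]
  ring

open Filter Topology

lemma eq_zero_of_eventually_mul_nonneg {φ : ℝ → ℝ} (hφ : ContinuousAt φ 0)
    (h : ∀ᶠ s in 𝓝 0, 0 ≤ s * φ s) : φ 0 = 0 := by
  apply le_antisymm
  · refine le_of_tendsto (hφ.tendsto.mono_left (nhdsWithin_le_nhds (s := Iio 0))) ?_
    filter_upwards [nhdsWithin_le_nhds h, self_mem_nhdsWithin] with s hs hs0
    exact nonpos_of_mul_nonneg_right hs hs0
  · refine ge_of_tendsto (hφ.tendsto.mono_left (nhdsWithin_le_nhds (s := Ioi 0))) ?_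
    filter_upwards [nhdsWithin_le_nhds h, self_mem_nhdsWithin] with s hs hs0
    exact nonneg_of_mul_nonneg_right hs hs0

lemma eventually_forall_pos_add {p : ℝ → ℝ → ℝ} (hp : IsCopulaDensity p) {f g : ℝ × ℝ → ℝ}
    (hf : Continuous f) (hg : Continuous g) {r : ℝ → ℝ} (hr : ContinuousAt r 0) :
    ∀ᶠ s in 𝓝 (0 : ℝ), ∀ z ∈ Icc (0 : ℝ) 1 ×ˢ Icc (0 : ℝ) 1,
      0 < p z.1 z.2 + (s * f z + s * r s * g z) := by
  have hK : IsCompact (Icc (0 : ℝ) 1 ×ˢ Icc (0 : ℝ) 1) := isCompact_Icc.prod isCompact_Icc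
  obtain ⟨w, hw, hmin⟩ := hK.exists_isMinOn ⟨(0, 0), by simp⟩ hp.smooth.continuousOn
  obtain ⟨C, hC⟩ := hK.exists_bound_of_continuousOn hf.continuousOn
  obtain ⟨D, hD⟩ := hK.exists_bound_of_continuousOn hg.continuousOn
  have hm : 0 < p w.1 w.2 := hp.pos _ hw.1 _ hw.2
  have hcont : ContinuousAt (fun s => |s| * C + |s * r s| * D) 0 := by fun_prop
  have hlt := hcont.eventually_lt (continuousAt_const (y := p w.1 w.2)) (by simpa using hm)
  filter_upwards [hlt] with s hs z hz
  have h₁ : |s * f z| ≤ |s| * C := by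
    rw [abs_mul]
    exact mul_le_mul_of_nonneg_left (hC z hz) (abs_nonneg _)
  have h₂ : |s * r s * g z| ≤ |s * r s| * D := by
    rw [abs_mul]
    exact mul_le_mul_of_nonneg_left (hD z hz) (abs_nonneg _)
  have h₃ : p w.1 w.2 ≤ p z.1 z.2 := hmin hz
  linarith [neg_abs_le (s * f z), neg_abs_le (s * r s * g z)]

lemma vanishesAtEndpoints_mul_one_sub : VanishesAtEndpoints (fun x => x * (1 - x)) where
  smooth := by fun_prop
  zero := by simp
  one := by simp

/-- The weak Euler–Lagrange equation of the constrained minimization problem. -/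
lemma exists_multiplier {p : ℝ → ℝ → ℝ} (hp : IsCopulaDensity p)
    (hmin : ∀ q : ℝ → ℝ → ℝ, IsCopulaDensity q → kendallTau q = kendallTau p →
      shannonInfo p ≤ shannonInfo q) :
    ∃ κ : ℝ, ∀ a b : ℝ → ℝ, VanishesAtEndpoints a → VanishesAtEndpoints b →
      ∫ z, Real.log (p z.1 z.2) * direction a b z ∂squareMeasure =
        κ * ∫ z, p z.1 z.2 * (a z.1 * b z.2) ∂squareMeasure := by
  set e : ℝ → ℝ := fun x => x * (1 - x) with he_def
  have he : VanishesAtEndpoints e := vanishesAtEndpoints_mul_one_sub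
  have hec := he.smooth.continuous
  have hpc : ContinuousOn (fun z : ℝ × ℝ => p z.1 z.2) (Icc 0 1 ×ˢ Icc 0 1) :=
    hp.smooth.continuousOn
  set A₂ := ∫ z, p z.1 z.2 * (e z.1 * e z.2) ∂squareMeasure with hA₂
  set L₂ := ∫ z, Real.log (p z.1 z.2) * direction e e z ∂squareMeasure with hL₂
  have hA₂pos : 0 < A₂ := by
    refine integral_squareMeasure_pos (α := 0) (β := 1) (γ := 0) (δ := 1)
      (hpc.mul (by fun_prop)).integrable_squareMeasure (fun z hz => ?_)
      zero_lt_one zero_lt_one le_rfl le_rfl le_rfl le_rfl (fun z hz => ?_)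
    · have := hp.pos z.1 (Ioc_subset_Icc_self hz.1) z.2 (Ioc_subset_Icc_self hz.2)
      have := hz.1.1.le
      have := hz.2.1.le
      have := sub_nonneg.2 hz.1.2
      have := sub_nonneg.2 hz.2.2
      simp only [he_def]
      positivity
    · have := hp.pos z.1 (Ioo_subset_Icc_self hz.1) z.2 (Ioo_subset_Icc_self hz.2)
      have := hz.1.1
      have := hz.2.1
      have := sub_pos.2 hz.1.2
      have := sub_pos.2 hz.2.2
      simp only [he_def]
      positivity
  refine ⟨L₂ / A₂, fun a b ha hb => ?_⟩
  set A₁ := ∫ z, p z.1 z.2 * (a z.1 * b z.2) ∂squareMeasure with hA₁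
  set L₁ := ∫ z, Real.log (p z.1 z.2) * direction a b z ∂squareMeasure with hL₁
  obtain ⟨M, N, R, hS⟩ := shannonInfo_add_direction_le hp ha hb he he
  set c := kendallForm (direction a b) (direction e e) with hc
  set r : ℝ → ℝ := fun s => -(4 * A₁) / (4 * A₂ + s * c) with hr_def
  have hden : ContinuousAt (fun s : ℝ => 4 * A₂ + s * c) 0 := by fun_prop
  have hden0 : 4 * A₂ + 0 * c ≠ 0 := by simp [hA₂pos.ne']
  have hr : ContinuousAt r 0 := continuousAt_const.div hden hden0
  have hev : ∀ᶠ s in 𝓝 (0 : ℝ),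
      0 ≤ s * ((L₁ + r s * L₂) + s * (M + r s * N + r s ^ 2 * R)) := by
    filter_upwards [eventually_forall_pos_add hp (contDiff_direction ha hb).continuous
      (contDiff_direction he he).continuous hr, hden.eventually_ne hden0] with s hs hs'
    have hq := hp.add_direction ha hb he he s (s * r s) hs
    have hτ := kendallTau_add_direction hp ha hb he he s (s * r s)
    have h0 : r s * (4 * A₂ + s * c) = -(4 * A₁) := div_mul_cancel₀ _ hs'
    have h1 := hmin _ hq (by
      rw [hτ, ← hA₁, ← hA₂, ← hc]
      linear_combination 2 * s * h0)
    have h2 := hS s (s * r s) hq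
    rw [← hL₁, ← hL₂] at h2
    nlinarith
  have h := eq_zero_of_eventually_mul_nonneg
    (φ := fun s => (L₁ + r s * L₂) + s * (M + r s * N + r s ^ 2 * R)) (by fun_prop) hev
  simp only [hr_def, zero_mul, add_zero] at h
  field_simp at h ⊢
  linarith

lemma integrable_squareMeasure_of_vanishing {f : ℝ × ℝ → ℝ} {K : Set (ℝ × ℝ)} (hK : IsCompact K)
    (hf : ContinuousOn f K) (h0 : ∀ z, z ∉ K → f z = 0) : Integrable f squareMeasure := by
  rw [squareMeasure_eq_restrict]
  exact ((hf.integrableOn_compact hK).integrable_of_forall_notMem_eq_zero h0).restrict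

lemma hasDerivAt_fderiv_snd {G : ℝ × ℝ → ℝ} {u v : ℝ} (hG : DifferentiableAt ℝ G (u, v)) :
    HasDerivAt (fun v' => G (u, v')) (fderiv ℝ G (u, v) (0, 1)) v :=
  hG.hasFDerivAt.comp_hasDerivAt v ((hasDerivAt_const v u).prodMk (hasDerivAt_id v))

lemma hasDerivAt_fderiv_fst {G : ℝ × ℝ → ℝ} {u v : ℝ} (hG : DifferentiableAt ℝ G (u, v)) :
    HasDerivAt (fun u' => G (u', v)) (fderiv ℝ G (u, v) (1, 0)) u :=
  hG.hasFDerivAt.comp_hasDerivAt u ((hasDerivAt_id u).prodMk (hasDerivAt_const u v))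

/-- A nonnegative smooth function on the line, positive exactly on `(c - ε, c + ε)`. -/
lemma exists_smooth_bump (c : ℝ) {ε : ℝ} (hε : 0 < ε) :
    ∃ a : ℝ → ℝ, ContDiff ℝ 3 a ∧ (∀ x, 0 ≤ a x) ∧ (∀ x ∈ Ioo (c - ε) (c + ε), 0 < a x) ∧
      (∀ x, x ∉ Ioo (c - ε) (c + ε) → a x = 0) ∧
      ∀ x, x ∉ Ioo (c - ε) (c + ε) → deriv a x = 0 := by
  let f : ContDiffBump c := ⟨ε / 2, ε, by positivity, by linarith⟩
  have hzero : ∀ x, x ∉ Ioo (c - ε) (c + ε) → f x = 0 := fun x hx => by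
    rw [← Real.ball_eq_Ioo, Metric.mem_ball, not_lt] at hx
    exact f.zero_of_le_dist hx
  refine ⟨f, f.contDiff, fun x => f.nonneg, fun x hx => ?_, hzero, fun x hx => ?_⟩
  · rw [← Real.ball_eq_Ioo] at hx
    exact f.pos_of_mem_ball hx
  · refine IsLocalMin.deriv_eq_zero (Eventually.of_forall fun y => ?_)
    rw [hzero x hx]
    exact f.nonneg

/-- The weak equation tested against products of bumps yields the pointwise equation for the mixed
second derivative of `log p`. -/
lemma mixed_deriv_log_eq_of_weak {p : ℝ → ℝ → ℝ} (hp : IsCopulaDensity p) {κ : ℝ}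
    (hκ : ∀ a b : ℝ → ℝ, VanishesAtEndpoints a → VanishesAtEndpoints b →
      ∫ z, Real.log (p z.1 z.2) * direction a b z ∂squareMeasure =
        κ * ∫ z, p z.1 z.2 * (a z.1 * b z.2) ∂squareMeasure)
    {G₁ G₂ : ℝ → ℝ → ℝ}
    (hG₁ : ∀ u ∈ Ioo (0 : ℝ) 1, ∀ v ∈ Ioo (0 : ℝ) 1,
      HasDerivAt (fun v' => Real.log (p u v')) (G₁ u v) v)
    (hG₂ : ∀ u ∈ Ioo (0 : ℝ) 1, ∀ v ∈ Ioo (0 : ℝ) 1,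
      HasDerivAt (fun u' => G₁ u' v) (G₂ u v) u)
    (hc₁ : ContinuousOn (Function.uncurry G₁) (Ioo 0 1 ×ˢ Ioo 0 1))
    (hc₂ : ContinuousOn (Function.uncurry G₂) (Ioo 0 1 ×ˢ Ioo 0 1))
    {u₀ v₀ : ℝ} (hu₀ : u₀ ∈ Ioo (0 : ℝ) 1) (hv₀ : v₀ ∈ Ioo (0 : ℝ) 1) :
    G₂ u₀ v₀ = κ * p u₀ v₀ := by
  by_contra hne
  set σ := G₂ u₀ v₀ - κ * p u₀ v₀ with hσ
  have hσ0 : σ ≠ 0 := sub_ne_zero.2 hne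
  have hUo : IsOpen (Ioo (0 : ℝ) 1 ×ˢ Ioo (0 : ℝ) 1) := isOpen_Ioo.prod isOpen_Ioo
  have hUK : Ioo (0 : ℝ) 1 ×ˢ Ioo (0 : ℝ) 1 ⊆ Icc 0 1 ×ˢ Icc 0 1 :=
    prod_mono Ioo_subset_Icc_self Ioo_subset_Icc_self
  have hpc : ContinuousOn (fun z : ℝ × ℝ => p z.1 z.2) (Icc 0 1 ×ˢ Icc 0 1) :=
    hp.smooth.continuousOn
  have hUmem := hUo.mem_nhds (show (u₀, v₀) ∈ Ioo (0 : ℝ) 1 ×ˢ Ioo (0 : ℝ) 1 from ⟨hu₀, hv₀⟩)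
  have hD : ContinuousOn (fun z : ℝ × ℝ => (G₂ z.1 z.2 - κ * p z.1 z.2) * σ)
      (Ioo 0 1 ×ˢ Ioo 0 1) :=
    ((ContinuousOn.sub hc₂ ((hpc.mono hUK).const_mul κ)).mul continuousOn_const)
  have hev : ∀ᶠ z in 𝓝 (u₀, v₀), z ∈ Ioo (0 : ℝ) 1 ×ˢ Ioo (0 : ℝ) 1 ∧
      0 < (G₂ z.1 z.2 - κ * p z.1 z.2) * σ :=
    Filter.Eventually.and hUmem ((hD.continuousAt hUmem).eventually_const_lt
      (by simpa only [← hσ] using mul_self_pos.2 hσ0))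
  obtain ⟨ε, hε, hball⟩ := Metric.nhds_basis_closedBall.eventually_iff.1 hev
  rw [← closedBall_prod_same, Real.closedBall_eq_Icc, Real.closedBall_eq_Icc] at hball
  set α := u₀ - ε
  set β := u₀ + ε
  set γ := v₀ - ε
  set δ := v₀ + ε
  have hαβ : α < β := by simp only [α, β]; linarith
  have hγδ : γ < δ := by simp only [γ, δ]; linarith
  have hRU : Icc α β ×ˢ Icc γ δ ⊆ Ioo (0 : ℝ) 1 ×ˢ Ioo (0 : ℝ) 1 := fun z hz => (hball hz).1
  have hl : (α, γ) ∈ Ioo (0 : ℝ) 1 ×ˢ Ioo (0 : ℝ) 1 :=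
    hRU ⟨left_mem_Icc.2 hαβ.le, left_mem_Icc.2 hγδ.le⟩
  have hr : (β, δ) ∈ Ioo (0 : ℝ) 1 ×ˢ Ioo (0 : ℝ) 1 :=
    hRU ⟨right_mem_Icc.2 hαβ.le, right_mem_Icc.2 hγδ.le⟩
  obtain ⟨a, hac, ha0, hapos, haz, hadz⟩ := exists_smooth_bump u₀ hε
  obtain ⟨b, hbc, hb0, hbpos, hbz, hbdz⟩ := exists_smooth_bump v₀ hε
  have ha : VanishesAtEndpoints a :=
    ⟨hac, haz _ fun h => h.1.not_ge hl.1.1.le, haz _ fun h => h.2.not_ge hr.1.2.le⟩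
  have hb : VanishesAtEndpoints b :=
    ⟨hbc, hbz _ fun h => h.1.not_ge hl.2.1.le, hbz _ fun h => h.2.not_ge hr.2.2.le⟩
  have hab : ∀ z : ℝ × ℝ, z ∉ Ioo α β ×ˢ Ioo γ δ → a z.1 * b z.2 = 0 := fun z hz => by
    rcases not_and_or.1 hz with h | h
    · rw [haz _ h, zero_mul]
    · rw [hbz _ h, mul_zero]
  have hdab : ∀ z : ℝ × ℝ, z ∉ Ioo α β ×ˢ Ioo γ δ → direction a b z = 0 := fun z hz => by
    rcases not_and_or.1 hz with h | h
    · rw [direction, hadz _ h, zero_mul]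
    · rw [direction, hbdz _ h, mul_zero]
  have hRo : Ioo α β ×ˢ Ioo γ δ ⊆ Ioc α β ×ˢ Ioc γ δ :=
    prod_mono Ioo_subset_Ioc_self Ioo_subset_Ioc_self
  have hRc : Ioo α β ×ˢ Ioo γ δ ⊆ Icc α β ×ˢ Icc γ δ :=
    prod_mono Ioo_subset_Icc_self Ioo_subset_Icc_self
  have hacont := hac.continuous
  have hbcont := hbc.continuous
  have hcF : ContinuousOn (fun z : ℝ × ℝ => G₂ z.1 z.2 * (a z.1 * b z.2))
      (Icc α β ×ˢ Icc γ δ) := ContinuousOn.mul (hc₂.mono hRU) (by fun_prop)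
  have hcL : ContinuousOn (fun z : ℝ × ℝ => Real.log (p z.1 z.2) * direction a b z)
      (Icc α β ×ˢ Icc γ δ) := (hp.continuousOn_log.mono (hRU.trans hUK)).mul
    (contDiff_direction ha hb).continuous.continuousOn
  have hiF : Integrable (fun z : ℝ × ℝ => G₂ z.1 z.2 * (a z.1 * b z.2)) squareMeasure :=
    integrable_squareMeasure_of_vanishing (isCompact_Icc.prod isCompact_Icc) hcF
      fun z hz => by rw [hab z fun h => hz (hRc h), mul_zero]
  have hip : Integrable (fun z : ℝ × ℝ => p z.1 z.2 * (a z.1 * b z.2)) squareMeasure :=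
    (hpc.mul (by fun_prop)).integrable_squareMeasure
  have hparts : ∫ z, Real.log (p z.1 z.2) * direction a b z ∂squareMeasure =
      ∫ z, G₂ z.1 z.2 * (a z.1 * b z.2) ∂squareMeasure := by
    rw [integral_squareMeasure_eq_of_vanishing hαβ.le hγδ.le hl.1.1.le hr.1.2.le hl.2.1.le
        hr.2.2.le hcL
        (fun z hz => by rw [hdab z fun h => hz (hRo h), mul_zero]),
      integral_squareMeasure_eq_of_vanishing hαβ.le hγδ.le hl.1.1.le hr.1.2.le hl.2.1.le
        hr.2.2.le hcF (fun z hz => by rw [hab z fun h => hz (hRo h), mul_zero])]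
    exact integral_integral_mul_deriv_mul_deriv (g := fun u v => Real.log (p u v)) hαβ.le hγδ.le
      ha.contDiff_one hb.contDiff_one (haz _ left_notMem_Ioo) (haz _ right_notMem_Ioo)
      (hbz _ left_notMem_Ioo) (hbz _ right_notMem_Ioo)
      (fun u hu v hv => hG₁ u (hRU (mk_mem_prod hu hv)).1 v (hRU (mk_mem_prod hu hv)).2)
      (fun u hu v hv => hG₂ u (hRU (mk_mem_prod hu hv)).1 v (hRU (mk_mem_prod hu hv)).2)
      (hc₁.mono hRU) (hc₂.mono hRU)
  have hpos : 0 < ∫ z : ℝ × ℝ, (G₂ z.1 z.2 * (a z.1 * b z.2) -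
      κ * (p z.1 z.2 * (a z.1 * b z.2))) * σ ∂squareMeasure := by
    have hfac : ∀ z : ℝ × ℝ, (G₂ z.1 z.2 * (a z.1 * b z.2) -
        κ * (p z.1 z.2 * (a z.1 * b z.2))) * σ =
        (G₂ z.1 z.2 - κ * p z.1 z.2) * σ * (a z.1 * b z.2) := fun z => by ring
    refine integral_squareMeasure_pos ((hiF.sub (hip.const_mul κ)).mul_const σ) (fun z _ => ?_)
      hαβ hγδ hl.1.1.le hr.1.2.le hl.2.1.le hr.2.2.le (fun z hz => ?_)
    · rw [hfac]
      by_cases hz : z ∈ Ioo α β ×ˢ Ioo γ δ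
      · exact mul_nonneg (hball (hRc hz)).2.le (mul_nonneg (ha0 _) (hb0 _))
      · rw [hab z hz, mul_zero]
    · rw [hfac]
      exact mul_pos (hball (hRc hz)).2 (mul_pos (hapos _ hz.1) (hbpos _ hz.2))
  rw [integral_mul_const, integral_sub hiF (hip.const_mul κ), integral_const_mul, ← hparts,
    hκ a b ha hb, sub_self, zero_mul] at hpos
  exact hpos.false

/-- Stationarity of MICK: a minimizer of the Shannon information over copula densities
with fixed Kendall's τ satisfies `∂²/∂u∂v log p = 8λ p` for some Lagrange multiplier `λ`. -/
theorem mick_satisfies_liouville (τ : ℝ) (hτ : τ ∈ Set.Ioo (-1 : ℝ) 1)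
    (p : ℝ → ℝ → ℝ) (hp : IsCopulaDensity p) (hK : kendallTau p = τ)
    (hmin : ∀ q : ℝ → ℝ → ℝ, IsCopulaDensity q → kendallTau q = τ →
      shannonInfo p ≤ shannonInfo q) :
    ∃ lam : ℝ, ∀ u ∈ Set.Ioo (0 : ℝ) 1, ∀ v ∈ Set.Ioo (0 : ℝ) 1,
      deriv (fun u' => deriv (fun v' => Real.log (p u' v')) v) u = 8 * lam * p u v := by
  subst hK
  obtain ⟨κ, hκ⟩ := exists_multiplier hp hmin
  have hUo : IsOpen (Ioo (0 : ℝ) 1 ×ˢ Ioo (0 : ℝ) 1) := isOpen_Ioo.prod isOpen_Ioo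
  set G : ℝ × ℝ → ℝ := fun z => Real.log (p z.1 z.2)
  have hGs : ContDiffOn ℝ 2 G (Ioo 0 1 ×ˢ Ioo 0 1) :=
    (hp.smooth.log fun z hz => (hp.pos z.1 hz.1 z.2 hz.2).ne').mono
      (prod_mono Ioo_subset_Icc_self Ioo_subset_Icc_self)
  set G₁ : ℝ × ℝ → ℝ := fun z => fderiv ℝ G z (0, 1)
  have hG₁s : ContDiffOn ℝ 1 G₁ (Ioo 0 1 ×ˢ Ioo 0 1) :=
    (hGs.fderiv_of_isOpen hUo (by norm_num)).clm_apply contDiffOn_const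
  set G₂ : ℝ × ℝ → ℝ := fun z => fderiv ℝ G₁ z (1, 0)
  have hG₂c : ContinuousOn G₂ (Ioo 0 1 ×ˢ Ioo 0 1) :=
    (hG₁s.continuousOn_fderiv_of_isOpen hUo le_rfl).clm_apply continuousOn_const
  have hd₁ : ∀ u ∈ Ioo (0 : ℝ) 1, ∀ v ∈ Ioo (0 : ℝ) 1,
      HasDerivAt (fun v' => Real.log (p u v')) (G₁ (u, v)) v := fun u hu v hv =>
    hasDerivAt_fderiv_snd (G := G) ((hGs.contDiffAt (hUo.mem_nhds ⟨hu, hv⟩)).differentiableAt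
      (by norm_num))
  have hd₂ : ∀ u ∈ Ioo (0 : ℝ) 1, ∀ v ∈ Ioo (0 : ℝ) 1,
      HasDerivAt (fun u' => G₁ (u', v)) (G₂ (u, v)) u := fun u hu v hv =>
    hasDerivAt_fderiv_fst (G := G₁) ((hG₁s.contDiffAt (hUo.mem_nhds ⟨hu, hv⟩)).differentiableAt
      (by norm_num))
  refine ⟨κ / 8, fun u hu v hv => ?_⟩
  have hin : (fun u' => deriv (fun v' => Real.log (p u' v')) v) =ᶠ[𝓝 u] fun u' => G₁ (u', v) := by
    filter_upwards [isOpen_Ioo.mem_nhds hu] with u' hu'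
    exact (hd₁ u' hu' v hv).deriv
  rw [hin.deriv_eq, (hd₂ u hu v hv).deriv]
  have h := mixed_deriv_log_eq_of_weak hp hκ (G₁ := fun u v => G₁ (u, v))
    (G₂ := fun u v => G₂ (u, v)) hd₁ hd₂ hG₁s.continuousOn hG₂c hu hv
  rw [h]
  ring
end
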